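/- arXiv:2101.02887 — 2 statements merged into one kernel-verified Lean document; each statement's English description precedes it below -/
import Mathlib

section
/- For all positive integers n, k, t, there exists a positive integer M with the following property. Let β_1,...,β_k be sets of simple curves in ℝ² such that within each β_i the curves are pairwise disjoint, and any two curves from different β_i, β_j intersect in at most t points. Let J be the set of all segments of curves in the union of the β_i. Then any M families, each consisting of n pairwise disjoint members of J, admit a system of disjoint representatives of size n. Moreover one may take M = C(n+k-1, k-1) · n · k^{(t(k-1)³/(2k³))·n⁴}. -/
/-- A simple curve in the plane: an injective continuous map from a closed interval. -/
structure SimpleCurve where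
  a : ℝ
  b : ℝ
  hab : a ≤ b
  f : ℝ → ℝ × ℝ
  cont : ContinuousOn f (Set.Icc a b)
  inj : Set.InjOn f (Set.Icc a b)

/-- The image of a simple curve. -/
def SimpleCurve.image (c : SimpleCurve) : Set (ℝ × ℝ) := c.f '' Set.Icc c.a c.b

/-- `s` is a segment of the curve `c`. -/
def IsSegmentOf (s : Set (ℝ × ℝ)) (c : SimpleCurve) : Prop :=
  ∃ x y : ℝ, c.a ≤ x ∧ x ≤ y ∧ y ≤ c.b ∧ s = c.f '' Set.Icc x y


open Classical in
/-- Greedy selection: `q` families with at least `q` segments each. -/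
lemma sdr_select {X B V : Type*} [Nonempty B] (seg : X × B → Set V)
    (hfam : ∀ x b b', b ≠ b' → Disjoint (seg (x, b)) (seg (x, b'))) :
    ∀ (q : ℕ) (T : Finset (X × B)) (Q : Finset X),
      (∀ U ⊆ T, U.Nonempty → ∃ e ∈ U, ∃ p ∈ seg e, ∀ e' ∈ U,
        ¬ Disjoint (seg e) (seg e') → p ∈ seg e') →
      Q.card = q →
      (∀ x ∈ Q, q ≤ (T.filter (fun e => e.1 = x)).card) →
      ∃ g : X → B, (∀ x ∈ Q, (x, g x) ∈ T) ∧
        ∀ x ∈ Q, ∀ y ∈ Q, x ≠ y → Disjoint (seg (x, g x)) (seg (y, g y)) := by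
  intro q
  induction q with
  | zero =>
    intro T Q hS hQ hT
    have hQ0 : Q = ∅ := Finset.card_eq_zero.mp hQ
    subst hQ0
    exact ⟨fun _ => Classical.arbitrary B, by simp, by simp⟩
  | succ q ih =>
    intro T Q hS hQ hT
    have hne : (T.filter (fun e => e.1 ∈ Q)).Nonempty := by
      obtain ⟨x, hx⟩ : Q.Nonempty := Finset.card_pos.mp (by omega)
      have h1 := hT x hx
      obtain ⟨e, he⟩ : (T.filter (fun e => e.1 = x)).Nonempty := Finset.card_pos.mp (by omega)
      simp only [Finset.mem_filter] at he
      exact ⟨e, by simp only [Finset.mem_filter]; exact ⟨he.1, he.2 ▸ hx⟩⟩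
    obtain ⟨⟨x0, b0⟩, he, p, hp, hpe⟩ := hS _ (Finset.filter_subset _ _) hne
    simp only [Finset.mem_filter] at he hpe
    obtain ⟨g, hg1, hg2⟩ := ih (T.filter (fun e => p ∉ seg e)) (Q.erase x0)
      (fun U hU => hS U (hU.trans (Finset.filter_subset _ _)))
      (by rw [Finset.card_erase_of_mem he.2]; omega)
      (by
        intro x hx
        have h1 := hT x (Finset.mem_of_mem_erase hx)
        have h2 : ((T.filter (fun e => e.1 = x)).filter (fun e => p ∈ seg e)).card ≤ 1 := by
          rw [Finset.card_le_one]
          rintro ⟨x1, b1⟩ h1 ⟨x2, b2⟩ h2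
          simp only [Finset.mem_filter] at h1 h2
          obtain ⟨⟨h11, rfl⟩, h13⟩ := h1
          obtain ⟨⟨h21, rfl⟩, h23⟩ := h2
          by_contra hne
          have : b1 ≠ b2 := fun h => hne (by rw [h])
          exact Set.disjoint_left.mp (hfam _ _ _ this) h13 h23
        have h3 := Finset.card_filter_add_card_filter_not (s := T.filter (fun e => e.1 = x))
          (fun e => p ∈ seg e)
        rw [Finset.filter_comm]
        omega)
    have key : ∀ y ∈ Q, y ≠ x0 → Disjoint (seg (x0, b0)) (seg (y, g y)) := by
      intro y hy hyx
      have h := hg1 y (Finset.mem_erase.mpr ⟨hyx, hy⟩)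
      simp only [Finset.mem_filter] at h
      by_contra hd
      exact h.2 (hpe (y, g y) ⟨h.1, hy⟩ hd)
    refine ⟨Function.update g x0 b0, ?_, ?_⟩
    · intro x hx
      by_cases hxx : x = x0
      · subst hxx; simpa using he.1
      · rw [Function.update_of_ne hxx]
        exact (Finset.mem_filter.mp (hg1 x (Finset.mem_erase.mpr ⟨hxx, hx⟩))).1
    · intro x hx y hy hxy
      by_cases hxx : x = x0
      · subst hxx
        rw [Function.update_self, Function.update_of_ne hxy.symm]
        exact key y hy hxy.symm
      · by_cases hyy : y = x0
        · subst hyy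
          rw [Function.update_self, Function.update_of_ne hxy]
          exact (key x hx hxy).symm
        · rw [Function.update_of_ne hxx, Function.update_of_ne hyy]
          exact hg2 x (Finset.mem_erase.mpr ⟨hxx, hx⟩) y (Finset.mem_erase.mpr ⟨hyy, hy⟩) hxy

open Classical in
/-- Greedy packing: either `r` disjoint segments from distinct families, or fewer than `r`
segments such that all segments (outside their families) meet one of them. -/
lemma sdr_pierce {X B V : Type*} (seg : X × B → Set V) :
    ∀ (r : ℕ) (T : Finset (X × B)),
      (∀ U ⊆ T, U.Nonempty → ∃ e ∈ U, ∃ p ∈ seg e, ∀ e' ∈ U,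
        ¬ Disjoint (seg e) (seg e') → p ∈ seg e') →
      (∃ W : Finset (X × B), W ⊆ T ∧ W.card = r ∧ ∀ e ∈ W, ∀ e' ∈ W, e ≠ e' →
        e.1 ≠ e'.1 ∧ Disjoint (seg e) (seg e')) ∨
      (∃ N : Finset (X × B), N ⊆ T ∧ N.card < r ∧ ∀ e ∈ T,
        (e.1 ∉ N.image Prod.fst ∨ ∀ e' ∈ T, e'.1 = e.1 → e' = e) →
        ∃ e0 ∈ N, ¬ Disjoint (seg e0) (seg e)) := by
  intro r
  induction r with
  | zero =>
    intro T hS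
    exact Or.inl ⟨∅, by simp, by simp, by simp⟩
  | succ r ih =>
    intro T hS
    by_cases hT : T.Nonempty
    swap
    · rw [Finset.not_nonempty_iff_eq_empty] at hT
      subst hT
      exact Or.inr ⟨∅, by simp, by simp, by simp⟩
    obtain ⟨e0, he0, p, hp, hpe⟩ := hS T (Finset.Subset.refl _) hT
    have hsub : T.filter (fun e => e.1 ≠ e0.1 ∧ p ∉ seg e) ⊆ T := Finset.filter_subset _ _
    rcases ih (T.filter (fun e => e.1 ≠ e0.1 ∧ p ∉ seg e)) (fun U hU => hS U (hU.trans hsub)) with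
      ⟨W, hWT, hWc, hW⟩ | ⟨N, hNT, hNc, hN⟩
    · left
      have hW0 : ∀ e ∈ W, e.1 ≠ e0.1 ∧ Disjoint (seg e0) (seg e) := by
        intro e he
        have h := Finset.mem_filter.mp (hWT he)
        refine ⟨h.2.1, ?_⟩
        by_contra hd
        exact h.2.2 (hpe e h.1 hd)
      refine ⟨insert e0 W, ?_, ?_, ?_⟩
      · exact Finset.insert_subset he0 (hWT.trans hsub)
      · rw [Finset.card_insert_of_notMem, hWc]
        intro h
        exact (hW0 _ h).1 rfl
      · intro e he e' he' hne
        rcases Finset.mem_insert.mp he with h1 | h1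
        · rcases Finset.mem_insert.mp he' with h2 | h2
          · exact absurd (h1.trans h2.symm) hne
          · rw [h1]
            exact ⟨(hW0 _ h2).1.symm, (hW0 _ h2).2⟩
        · rcases Finset.mem_insert.mp he' with h2 | h2
          · rw [h2]
            exact ⟨(hW0 _ h1).1, (hW0 _ h1).2.symm⟩
          · exact hW e h1 e' h2 hne
    · right
      refine ⟨insert e0 N, Finset.insert_subset he0 (hNT.trans hsub), ?_, ?_⟩
      · have := Finset.card_insert_le e0 N
        omega
      · intro e he hor
        have hself : ¬ Disjoint (seg e0) (seg e0) := fun h => Set.disjoint_left.mp h hp hp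
        by_cases hpe' : p ∈ seg e
        · exact ⟨e0, Finset.mem_insert_self _ _, fun h => Set.disjoint_left.mp h hp hpe'⟩
        by_cases h1 : e.1 = e0.1
        · rcases hor with hor | hor
          · exact absurd (Finset.mem_image.mpr ⟨e0, Finset.mem_insert_self _ _, h1.symm⟩) hor
          · have := hor e0 he0 h1.symm
            subst this
            exact absurd hp hpe'
        · obtain ⟨e1, he1, hd⟩ := hN e (Finset.mem_filter.mpr ⟨he, h1, hpe'⟩) (by
            rcases hor with hor | hor
            · left
              intro h
              apply hor
              rw [Finset.image_insert]
              exact Finset.mem_insert_of_mem h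
            · right
              intro e' he' h
              exact hor e' (hsub he') h)
          exact ⟨e1, Finset.mem_insert_of_mem he1, hd⟩

open Classical in
/-- Repeated halving. -/
lemma sdr_halve {X Z : Type*} (A C : Z → X → Prop) (h : ∀ z x, A z x ∨ C z x) (S : Finset Z)
    (Q : Finset X) :
    ∃ Q' ⊆ Q, Q.card ≤ 2 ^ S.card * Q'.card ∧
      ∀ z ∈ S, (∀ x ∈ Q', A z x) ∨ (∀ x ∈ Q', C z x) := by
  induction S using Finset.induction_on with
  | empty => exact ⟨Q, Finset.Subset.refl _, by simp, by simp⟩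
  | insert z S hz ih =>
    obtain ⟨Q', hsub, hc, hQ'⟩ := ih
    have hsum := Finset.card_filter_add_card_filter_not (s := Q') (fun x => A z x)
    have hC : ∀ x ∈ Q'.filter (fun x => ¬ A z x), C z x := by
      intro x hx
      exact (h z x).resolve_left (Finset.mem_filter.mp hx).2
    have hA : ∀ x ∈ Q'.filter (fun x => A z x), A z x := fun x hx => (Finset.mem_filter.mp hx).2
    have main : ∀ Q'' ⊆ Q', Q'.card ≤ 2 * Q''.card →
        ((∀ x ∈ Q'', A z x) ∨ (∀ x ∈ Q'', C z x)) →
        ∃ Q' ⊆ Q, Q.card ≤ 2 ^ (insert z S).card * Q'.card ∧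
        ∀ z' ∈ insert z S, (∀ x ∈ Q', A z' x) ∨ (∀ x ∈ Q', C z' x) := by
      intro Q'' hs hcc hac
      refine ⟨Q'', hs.trans hsub, ?_, ?_⟩
      · rw [Finset.card_insert_of_notMem hz, pow_succ, mul_assoc]
        exact hc.trans (Nat.mul_le_mul_left _ hcc)
      · intro z' hz'
        rcases Finset.mem_insert.mp hz' with rfl | hz'
        · exact hac
        · rcases hQ' z' hz' with h1 | h1
          · exact Or.inl fun x hx => h1 x (hs hx)
          · exact Or.inr fun x hx => h1 x (hs hx)
    by_cases hle : (Q'.filter (fun x => ¬ A z x)).card ≤ (Q'.filter (fun x => A z x)).card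
    · exact main _ (Finset.filter_subset _ _) (by omega) (Or.inl hA)
    · exact main _ (Finset.filter_subset _ _) (by omega) (Or.inr hC)

/-- Number of increasing pairs. -/
lemma sdr_pairs {k : ℕ} (S : Finset (Fin k)) :
    2 * (S.offDiag.filter (fun q => q.1 < q.2)).card = S.card * (S.card - 1) := by
  have h1 := Finset.card_filter_add_card_filter_not (s := S.offDiag) (fun q => q.1 < q.2)
  have h2 : (S.offDiag.filter (fun q => ¬ q.1 < q.2)).card
      = (S.offDiag.filter (fun q => q.1 < q.2)).card := by
    apply Finset.card_bij (fun q _ => (q.2, q.1))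
    · rintro ⟨a, b⟩ h
      simp only [Finset.mem_filter, Finset.mem_offDiag] at h ⊢
      exact ⟨⟨h.1.2.1, h.1.1, h.1.2.2.symm⟩, lt_of_le_of_ne (not_lt.mp h.2) h.1.2.2.symm⟩
    · rintro ⟨a, b⟩ _ ⟨c, d⟩ _ h
      simp only [Prod.mk.injEq] at h ⊢
      exact ⟨h.2, h.1⟩
    · rintro ⟨a, b⟩ h
      simp only [Finset.mem_filter, Finset.mem_offDiag] at h
      exact ⟨(b, a), by
        simp only [Finset.mem_filter, Finset.mem_offDiag]
        exact ⟨⟨h.1.2.1, h.1.1, h.1.2.2.symm⟩, not_lt.mpr h.2.le⟩, rfl⟩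
  rw [Finset.offDiag_card] at h1
  have : S.card * (S.card - 1) = S.card * S.card - S.card := by
    rw [Nat.mul_sub, mul_one]
  omega

/-- The exponent inequality. -/
lemma sdr_exponent (n k t s p : ℕ) (hs : 2 ≤ s) (hsn : s ≤ n) (hsk : s ≤ k)
    (hp : 2 * p = s * (s - 1)) :
    ((p * ((n - 1) * (n - 1)) * t : ℕ) : ℝ) ≤
      ((t : ℝ) * ((k : ℝ) - 1) ^ 3 / (2 * (k : ℝ) ^ 3)) * (n : ℝ) ^ 4 := by
  obtain ⟨s, rfl⟩ : ∃ a, s = a + 1 := ⟨s - 1, by omega⟩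
  obtain ⟨n, rfl⟩ : ∃ a, n = a + 1 := ⟨n - 1, by omega⟩
  obtain ⟨k, rfl⟩ : ∃ a, k = a + 1 := ⟨k - 1, by omega⟩
  simp only [Nat.add_sub_cancel] at *
  have hp' : (2 : ℝ) * p = (s + 1) * s := by exact_mod_cast hp
  have hs1 : (1 : ℝ) ≤ s := by exact_mod_cast (by omega : 1 ≤ s)
  have hsn' : (s : ℝ) ≤ n := by exact_mod_cast (by omega : s ≤ n)
  have hsk' : (s : ℝ) ≤ k := by exact_mod_cast (by omega : s ≤ k)
  push_cast
  have hk0 : (0 : ℝ) < (k : ℝ) + 1 := by positivity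
  have hs0 : (0 : ℝ) < (s : ℝ) + 1 := by positivity
  have e1 : (s : ℝ) / (s + 1) ≤ k / (k + 1) := by
    rw [div_le_div_iff₀ hs0 hk0]; nlinarith
  have e2 : ((s : ℝ) / (s + 1)) ^ 3 ≤ (k / (k + 1)) ^ 3 := by
    gcongr
  have e3 : ((s : ℝ) + 1) ^ 2 * n ≤ s * (n + 1) ^ 2 := by
    nlinarith [mul_nonneg (sub_nonneg.mpr hsn')
      (by nlinarith : (0 : ℝ) ≤ s * n - 1)]
  have e4 : (((s : ℝ) + 1) ^ 2 * n) ^ 2 ≤ (s * (n + 1) ^ 2) ^ 2 := by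
    gcongr
  have e5 : ((s : ℝ) + 1) * s * (n * n) ≤ (s / (s + 1)) ^ 3 * (n + 1) ^ 4 := by
    rw [div_pow, div_mul_eq_mul_div, le_div_iff₀ (by positivity)]
    have : (0 : ℝ) ≤ s := by positivity
    nlinarith [mul_le_mul_of_nonneg_left e4 this]
  have e6 : ((s : ℝ) + 1) * s * (n * n) ≤ (k / (k + 1)) ^ 3 * (n + 1) ^ 4 :=
    e5.trans (by gcongr)
  have e7 : (p : ℝ) * (n * n) * t = (t / 2) * ((s + 1) * s * (n * n)) := by
    rw [← hp']; ring
  rw [e7]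
  calc (t / 2 : ℝ) * ((s + 1) * s * (n * n)) ≤ (t / 2) * ((k / (k + 1)) ^ 3 * (n + 1) ^ 4) := by
        gcongr
    _ = _ := by
        field_simp
        ring

open Classical in
/-- Segments of curves in one class: one with the least right end on its curve is simplicial. -/
lemma sdr_simplicial {ι : Type*} (β : Set SimpleCurve)
    (hβ : ∀ c ∈ β, ∀ c' ∈ β, c ≠ c' → Disjoint c.image c'.image)
    (seg : ι → Set (ℝ × ℝ)) (cv : ι → SimpleCurve)
    (hseg : ∀ e, IsSegmentOf (seg e) (cv e)) (U : Finset ι)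
    (hU : ∀ e ∈ U, cv e ∈ β) (hne : U.Nonempty) :
    ∃ e ∈ U, ∃ p ∈ seg e, ∀ e' ∈ U, ¬ Disjoint (seg e) (seg e') → p ∈ seg e' := by
  choose lo hi h1 h2 h3 h4 using hseg
  obtain ⟨e0, he0⟩ := hne
  obtain ⟨e, he, hmin⟩ := Finset.exists_min_image (U.filter (fun e => cv e = cv e0)) hi
    ⟨e0, by simp [he0]⟩
  simp only [Finset.mem_filter] at he hmin
  refine ⟨e, he.1, (cv e).f (hi e), ?_, ?_⟩
  · rw [h4]
    exact ⟨hi e, ⟨h2 e, le_rfl⟩, rfl⟩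
  · intro e' he' hd
    obtain ⟨q, hq, hq'⟩ := Set.not_disjoint_iff.mp hd
    rw [h4] at hq hq'
    obtain ⟨u, hu, rfl⟩ := hq
    obtain ⟨v, hv, hvu⟩ := hq'
    have hu' : u ∈ Set.Icc (cv e).a (cv e).b := ⟨(h1 e).trans hu.1, hu.2.trans (h3 e)⟩
    have hv' : v ∈ Set.Icc (cv e').a (cv e').b := ⟨(h1 e').trans hv.1, hv.2.trans (h3 e')⟩
    have hcc : cv e' = cv e := by
      by_contra hcc
      exact Set.disjoint_left.mp (hβ _ (hU _ he') _ (hU _ he.1) hcc) ⟨v, hv', hvu⟩ ⟨u, hu', rfl⟩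
    have hm := hmin e' ⟨he', hcc.trans he.2⟩
    rw [h4 e']
    rw [hcc] at hvu hv' ⊢
    have := (cv e).inj hv' hu' hvu
    subst this
    exact ⟨hi e, ⟨hv.1.trans hu.2, hm⟩, rfl⟩

open Classical in
/-- Once segments of different classes are disjoint, `n` families of the same type suffice. -/
lemma sdr_finish {n k M : ℕ} (hn : 0 < n) (F : Fin M → Fin n → Set (ℝ × ℝ))
    (hfam : ∀ x, ∀ b b', b ≠ b' → Disjoint (F x b) (F x b'))
    (cl : Fin M → Fin n → Fin k)
    (hsimp : ∀ i, ∀ U : Finset (Fin M × Fin n), (∀ e ∈ U, cl e.1 e.2 = i) → U.Nonempty →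
      ∃ e ∈ U, ∃ p ∈ F e.1 e.2, ∀ e' ∈ U, ¬ Disjoint (F e.1 e.2) (F e'.1 e'.2) →
        p ∈ F e'.1 e'.2)
    (τ : Fin k → ℕ) (Q : Finset (Fin M)) (hQ : n ≤ Q.card)
    (hτ : ∀ x ∈ Q, ∀ i, (Finset.univ.filter (fun b => cl x b = i)).card = τ i)
    (hx : ∀ x ∈ Q, ∀ y ∈ Q, ∀ b b', cl x b ≠ cl y b' → Disjoint (F x b) (F y b')) :
    ∃ (P : Fin n → Fin M) (g : Fin n → Fin n), Function.Injective P ∧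
      ∀ j j' : Fin n, j ≠ j' → Disjoint (F (P j) (g j)) (F (P j') (g j')) := by
  have : Nonempty (Fin n) := ⟨⟨0, hn⟩⟩
  obtain ⟨Q', hQ', hc⟩ := Finset.exists_subset_card_eq hQ
  let φ : Fin n → Fin M := fun j => (Q'.equivFinOfCardEq hc).symm j
  have hφi : Function.Injective φ := fun a b h =>
    (Q'.equivFinOfCardEq hc).symm.injective (Subtype.ext h)
  have hφQ : ∀ j, φ j ∈ Q := fun j => hQ' ((Q'.equivFinOfCardEq hc).symm j).2
  let γ : Fin n → Fin k := fun j => cl (φ ⟨0, hn⟩) j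
  have hsel : ∀ i, ∃ g : Fin M → Fin n,
      (∀ j, γ j = i → cl (φ j) (g (φ j)) = i) ∧
      ∀ j j', γ j = i → γ j' = i → j ≠ j' →
        Disjoint (F (φ j) (g (φ j))) (F (φ j') (g (φ j'))) := by
    intro i
    obtain ⟨g, hg1, hg2⟩ := sdr_select (fun e : Fin M × Fin n => F e.1 e.2)
      (fun x b b' h => hfam x b b' h) (τ i)
      (Finset.univ.filter (fun e => cl e.1 e.2 = i))
      ((Finset.univ.filter (fun j => γ j = i)).image φ)
      (fun U hU hne => hsimp i U (fun e he => (Finset.mem_filter.mp (hU he)).2) hne)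
      (by
        rw [Finset.card_image_of_injective _ hφi]
        exact hτ _ (hφQ _) i)
      (by
        intro x hx
        obtain ⟨j, -, rfl⟩ := Finset.mem_image.mp hx
        rw [← hτ _ (hφQ j) i]
        apply Finset.card_le_card_of_injOn (fun b => (φ j, b))
        · intro b hb
          simpa using hb
        · intro b _ b' _ h
          exact (Prod.mk.inj h).2)
    have hm : ∀ j, γ j = i → φ j ∈ (Finset.univ.filter (fun j => γ j = i)).image φ := by
      intro j hj
      exact Finset.mem_image_of_mem _ (by simpa using hj)
    refine ⟨g, ?_, ?_⟩
    · intro j hj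
      simpa using hg1 (φ j) (hm j hj)
    · intro j j' hj hj' hne
      exact hg2 _ (hm j hj) _ (hm j' hj') (fun h => hne (hφi h))
  choose g hg1 hg2 using hsel
  refine ⟨φ, fun j => g (γ j) (φ j), hφi, ?_⟩
  intro j j' hne
  by_cases h : γ j = γ j'
  · have := hg2 (γ j) j j' rfl h.symm hne
    change Disjoint (F (φ j) (g (γ j) (φ j))) (F (φ j') (g (γ j') (φ j')))
    rw [← h]
    exact this
  · apply hx _ (hφQ j) _ (hφQ j')
    change cl (φ j) (g (γ j) (φ j)) ≠ cl (φ j') (g (γ j') (φ j'))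
    rw [hg1 _ j rfl, hg1 _ j' rfl]
    exact h

open Classical in
/-- The main combinatorial step for families of one mixed type. -/
lemma sdr_mixed {n k t M : ℕ} (hn : 0 < n) (ht : 0 < t) (β : Fin k → Set SimpleCurve)
    (hβ : ∀ i, ∀ c ∈ β i, ∀ c' ∈ β i, c ≠ c' → Disjoint c.image c'.image)
    (hβt : ∀ i j, i ≠ j → ∀ c ∈ β i, ∀ c' ∈ β j,
            (c.image ∩ c'.image).Finite ∧ (c.image ∩ c'.image).ncard ≤ t)
    (F : Fin M → Fin n → Set (ℝ × ℝ))
    (hfam : ∀ x, ∀ b b', b ≠ b' → Disjoint (F x b) (F x b'))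
    (cl : Fin M → Fin n → Fin k) (cv : Fin M → Fin n → SimpleCurve)
    (hcv : ∀ x b, cv x b ∈ β (cl x b)) (hseg : ∀ x b, IsSegmentOf (F x b) (cv x b))
    (τ : Fin k → ℕ) (Q : Finset (Fin M))
    (hτ : ∀ x ∈ Q, ∀ i, (Finset.univ.filter (fun b => cl x b = i)).card = τ i)
    (hτn : ∑ i, τ i = n)
    (S : Finset (Fin k)) (hS : S = Finset.univ.filter (fun i => τ i ≠ 0)) (hS2 : 2 ≤ S.card)
    (hQ : n * 2 ^ ((S.offDiag.filter (fun q => q.1 < q.2)).card * ((n - 1) * (n - 1)) * t)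
      ≤ Q.card) :
    ∃ (P : Fin n → Fin M) (g : Fin n → Fin n), Function.Injective P ∧
      ∀ j j' : Fin n, j ≠ j' → Disjoint (F (P j) (g j)) (F (P j') (g j')) := by
  let seg : Fin M × Fin n → Set (ℝ × ℝ) := fun e => F e.1 e.2
  have hsimp : ∀ i, ∀ U : Finset (Fin M × Fin n), (∀ e ∈ U, cl e.1 e.2 = i) → U.Nonempty →
      ∃ e ∈ U, ∃ p ∈ F e.1 e.2, ∀ e' ∈ U, ¬ Disjoint (F e.1 e.2) (F e'.1 e'.2) →
        p ∈ F e'.1 e'.2 := by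
    intro i U hU hne
    exact sdr_simplicial (β i) (hβ i) seg (fun e => cv e.1 e.2) (fun e => hseg e.1 e.2) U
      (fun e he => hU e he ▸ hcv e.1 e.2) hne
  let T : Fin k → Finset (Fin M × Fin n) := fun i =>
    Finset.univ.filter (fun e => cl e.1 e.2 = i ∧ e.1 ∈ Q)
  have hTmem : ∀ i e, e ∈ T i ↔ cl e.1 e.2 = i ∧ e.1 ∈ Q := by
    intro i e; simp [T]
  have hp := fun i => sdr_pierce seg n (T i)
    (fun U hU hne => hsimp i U (fun e he => ((hTmem i e).mp (hU he)).1) hne)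
  by_cases hbig : ∃ i, ∃ W : Finset (Fin M × Fin n), W ⊆ T i ∧ W.card = n ∧
      ∀ e ∈ W, ∀ e' ∈ W, e ≠ e' → e.1 ≠ e'.1 ∧ Disjoint (seg e) (seg e')
  · obtain ⟨i, W, -, hWc, hW⟩ := hbig
    let φ := (W.equivFinOfCardEq hWc).symm
    refine ⟨fun j => (φ j).1.1, fun j => (φ j).1.2, ?_, ?_⟩
    · intro a b hab
      by_contra hne
      have : (φ a).1 ≠ (φ b).1 := fun h => hne (φ.injective (Subtype.ext h))
      exact (hW _ (φ a).2 _ (φ b).2 this).1 hab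
    · intro a b hne
      have : (φ a).1 ≠ (φ b).1 := fun h => hne (φ.injective (Subtype.ext h))
      exact (hW _ (φ a).2 _ (φ b).2 this).2
  have hp' := fun i => (hp i).resolve_left (fun h => hbig ⟨i, h⟩)
  choose N hNT hNc hN using hp'
  let R : Fin k → Finset (Fin M) := fun i => if τ i ≤ 1 then ∅ else (N i).image Prod.fst
  have hRc : ∀ i ∈ S, (R i).card ≤ (n - 1) * (τ i - 1) := by
    intro i _
    by_cases h : τ i ≤ 1
    · simp [R, h]
    · have h1 : (R i).card ≤ n - 1 := by
        simp only [R, h, if_false]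
        have := hNc i
        exact Finset.card_image_le.trans (by omega)
      exact h1.trans (Nat.le_mul_of_pos_right _ (by omega))
  let L := S.biUnion R
  have hsumS : ∑ i ∈ S, τ i = n := by
    rw [← hτn, hS, Finset.sum_filter_ne_zero]
  have hsum1 : ∑ i ∈ S, (τ i - 1) + S.card = n := by
    rw [← hsumS, Finset.card_eq_sum_ones, ← Finset.sum_add_distrib]
    apply Finset.sum_congr rfl
    intro i hi
    rw [hS, Finset.mem_filter] at hi
    have := hi.2
    omega
  have hLc : L.card ≤ (n - 1) * (n - 2) := by
    calc L.card ≤ ∑ i ∈ S, (R i).card := Finset.card_biUnion_le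
      _ ≤ ∑ i ∈ S, (n - 1) * (τ i - 1) := Finset.sum_le_sum hRc
      _ = (n - 1) * ∑ i ∈ S, (τ i - 1) := by rw [Finset.mul_sum]
      _ ≤ (n - 1) * (n - 2) := Nat.mul_le_mul_left _ (by omega)
  let D := S.offDiag.filter (fun q => q.1 < q.2)
  have hfin : ∀ (q : Fin k × Fin k), q ∈ D → ∀ e ∈ N q.1, ∀ e' ∈ N q.2,
      ((cv e.1 e.2).image ∩ (cv e'.1 e'.2).image).Finite ∧
      ((cv e.1 e.2).image ∩ (cv e'.1 e'.2).image).ncard ≤ t := by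
    intro q hq e he e' he'
    have h1 := ((hTmem _ _).mp (hNT _ he)).1
    have h2 := ((hTmem _ _).mp (hNT _ he')).1
    have h3 := (Finset.mem_filter.mp hq).2
    exact hβt q.1 q.2 h3.ne _ (h1 ▸ hcv e.1 e.2) _ (h2 ▸ hcv e'.1 e'.2)
  let pts : (Fin M × Fin n) × (Fin M × Fin n) → Finset (ℝ × ℝ) := fun w =>
    if h : ((cv w.1.1 w.1.2).image ∩ (cv w.2.1 w.2.2).image).Finite then h.toFinset else ∅
  let Z : Finset ((Fin k × Fin k) × (ℝ × ℝ)) := D.biUnion (fun q =>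
    (N q.1 ×ˢ N q.2).biUnion (fun w => (pts w).image (fun p => (q, p))))
  have hZc : Z.card ≤ D.card * ((n - 1) * (n - 1)) * t := by
    rw [mul_assoc]
    apply Finset.card_biUnion_le_card_mul
    intro q hq
    have h1 : (N q.1 ×ˢ N q.2).card ≤ (n - 1) * (n - 1) := by
      rw [Finset.card_product]
      have h1 := hNc q.1
      have h2 := hNc q.2
      exact Nat.mul_le_mul (by omega) (by omega)
    refine le_trans ?_ (Nat.mul_le_mul_right t h1)
    apply Finset.card_biUnion_le_card_mul
    rintro ⟨e, e'⟩ hw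
    rw [Finset.mem_product] at hw
    obtain ⟨h2, h3⟩ := hfin q hq e hw.1 e' hw.2
    refine Finset.card_image_le.trans ?_
    simp only [pts, h2, dif_pos]
    rw [Set.ncard_eq_toFinset_card _ h2] at h3
    exact h3
  obtain ⟨Q', hQ'sub, hQ'c, hQ'⟩ := sdr_halve
    (fun (z : (Fin k × Fin k) × (ℝ × ℝ)) (x : Fin M) =>
      z.1.1 ≠ z.1.2 → ∀ b, cl x b = z.1.1 → z.2 ∉ F x b)
    (fun z x => z.1.1 ≠ z.1.2 → ∀ b, cl x b = z.1.2 → z.2 ∉ F x b)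
    (by
      intro z x
      by_contra hcon
      push Not at hcon
      obtain ⟨⟨h1, b, hb, hz⟩, -, b', hb', hz'⟩ := hcon
      have : b ≠ b' := by
        rintro rfl
        exact h1 (hb.symm.trans hb')
      exact Set.disjoint_left.mp (hfam x b b' this) hz hz') Z (Q \ L)
  have hcount : n ≤ Q'.card := by
    by_contra hlt
    have hn2 : 2 ≤ n := by omega
    have hD : 1 ≤ D.card := by
      have := sdr_pairs S
      have h3 : 2 * 1 ≤ S.card * (S.card - 1) := Nat.mul_le_mul hS2 (by omega)
      change 2 * D.card = _ at this
      omega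
    set E := D.card * ((n - 1) * (n - 1)) * t with hE
    have hE1 : (n - 1) * (n - 1) ≤ E := by
      calc (n - 1) * (n - 1) = 1 * ((n - 1) * (n - 1)) * 1 := by ring
        _ ≤ E := Nat.mul_le_mul (Nat.mul_le_mul_right _ hD) ht
    have h2E : E < 2 ^ E := Nat.lt_two_pow_self
    have h4 : (n - 1) * (n - 2) ≤ (n - 1) * (n - 1) := Nat.mul_le_mul_left _ (by omega)
    have h5 : Q.card - L.card ≤ (Q \ L).card := Finset.le_card_sdiff _ _
    have h6 : (Q \ L).card ≤ 2 ^ E * (n - 1) :=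
      hQ'c.trans (Nat.mul_le_mul (Nat.pow_le_pow_right (by norm_num) hZc) (by omega))
    have h7 : n * 2 ^ E ≤ Q.card := hQ
    have h8 : n * 2 ^ E = 2 ^ E * (n - 1) + 2 ^ E := by
      obtain ⟨m, rfl⟩ : ∃ m, n = m + 1 := ⟨n - 1, by omega⟩
      simp only [Nat.add_sub_cancel]; ring
    omega
  have hon : ∀ x ∈ Q', ∀ b, ∃ e0 ∈ N (cl x b), cv e0.1 e0.2 = cv x b := by
    intro x hx b
    have hxQ := Finset.mem_sdiff.mp (hQ'sub hx)
    have hxT : (x, b) ∈ T (cl x b) := (hTmem _ _).mpr ⟨rfl, hxQ.1⟩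
    obtain ⟨e0, he0, hd⟩ := hN (cl x b) (x, b) hxT (by
      by_cases h1 : τ (cl x b) ≤ 1
      · right
        rintro ⟨x', b'⟩ he' hxx
        simp only at hxx
        subst hxx
        have h2 := ((hTmem _ _).mp he').1
        have h3 := hτ x' hxQ.1 (cl x' b)
        rw [← h3, Finset.card_le_one] at h1
        have := h1 b' (by simpa using h2) b (by simp)
        rw [this]
      · left
        intro hmem
        apply hxQ.2
        refine Finset.mem_biUnion.mpr ⟨cl x b, ?_, ?_⟩
        · rw [hS]
          simp only [Finset.mem_filter, Finset.mem_univ, true_and]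
          omega
        · simp only [R, h1, if_false]
          convert hmem)
    refine ⟨e0, he0, ?_⟩
    by_contra hne
    apply hd
    have h1 := ((hTmem _ _).mp (hNT _ he0)).1
    have hsubim : ∀ y c, F y c ⊆ (cv y c).image := by
      intro y c
      obtain ⟨u, v, h1, h2, h3, h4⟩ := hseg y c
      rw [h4]
      exact Set.image_mono (Set.Icc_subset_Icc h1 h3)
    exact (hβ (cl x b) _ (h1 ▸ hcv e0.1 e0.2) _ (hcv x b) hne).mono (hsubim _ _) (hsubim _ _)
  have hsubim : ∀ y c, F y c ⊆ (cv y c).image := by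
    intro y c
    obtain ⟨u, v, h1, h2, h3, h4⟩ := hseg y c
    rw [h4]
    exact Set.image_mono (Set.Icc_subset_Icc h1 h3)
  have hmemS : ∀ x ∈ Q, ∀ b, cl x b ∈ S := by
    intro x hx b
    rw [hS]
    simp only [Finset.mem_filter, Finset.mem_univ, true_and]
    rw [← hτ x hx]
    exact (Finset.card_pos.mpr ⟨b, by simp⟩).ne'
  have hlt : ∀ x ∈ Q', ∀ y ∈ Q', ∀ b b', cl x b < cl y b' → Disjoint (F x b) (F y b') := by
    intro x hx y hy b b' hlt
    rw [Set.disjoint_left]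
    intro p hpx hpy
    obtain ⟨e, he, hec⟩ := hon x hx b
    obtain ⟨e', he', hec'⟩ := hon y hy b'
    have hqD : (cl x b, cl y b') ∈ D := by
      refine Finset.mem_filter.mpr ⟨Finset.mem_offDiag.mpr ⟨?_, ?_, hlt.ne⟩, hlt⟩
      · exact hmemS x (Finset.mem_sdiff.mp (hQ'sub hx)).1 b
      · exact hmemS y (Finset.mem_sdiff.mp (hQ'sub hy)).1 b'
    have hfi := (hfin _ hqD e he e' he').1
    have hz : ((cl x b, cl y b'), p) ∈ Z := by
      refine Finset.mem_biUnion.mpr ⟨_, hqD, Finset.mem_biUnion.mpr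
        ⟨(e, e'), Finset.mem_product.mpr ⟨he, he'⟩, Finset.mem_image.mpr ⟨p, ?_, rfl⟩⟩⟩
      simp only [pts, hfi, dif_pos, Set.Finite.mem_toFinset]
      rw [hec, hec']
      exact ⟨hsubim _ _ hpx, hsubim _ _ hpy⟩
    rcases hQ' _ hz with h | h
    · exact h x hx hlt.ne b rfl hpx
    · exact h y hy hlt.ne b' rfl hpy
  refine sdr_finish hn F hfam cl hsimp τ Q' hcount
    (fun x hx i => hτ x (Finset.mem_sdiff.mp (hQ'sub hx)).1 i) ?_
  intro x hx y hy b b' hne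
  rcases lt_or_gt_of_ne hne with h | h
  · exact hlt x hx y hy b b' h
  · exact (hlt y hy x hx b' b h).symm

/-- Theorem 1.3: for `k` groups of pairwise-disjoint simple curves, any two curves from
different groups meeting in at most `t` points, there is `M` (at most
`C(n+k-1,k-1)·n·k^{(t(k-1)³/(2k³))n⁴}`) such that any `M` families of `n` disjoint
segments have an SDR of size `n`. -/
theorem stmt_5 (n k t : ℕ) (hn : 0 < n) (hk : 0 < k) (ht : 0 < t) :
    ∃ M : ℕ, 0 < M ∧
      M ≤ ⌈((n + k - 1).choose (k - 1) : ℝ) * n *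
            (k : ℝ) ^ (((t : ℝ) * ((k : ℝ) - 1) ^ 3 / (2 * (k : ℝ) ^ 3)) * (n : ℝ) ^ 4)⌉₊ ∧
      ∀ (β : Fin k → Set SimpleCurve),
        (∀ i, ∀ c ∈ β i, ∀ c' ∈ β i, c ≠ c' → Disjoint c.image c'.image) →
        (∀ i j, i ≠ j → ∀ c ∈ β i, ∀ c' ∈ β j,
            (c.image ∩ c'.image).Finite ∧ (c.image ∩ c'.image).ncard ≤ t) →
        ∀ F : Fin M → Fin n → Set (ℝ × ℝ),
          (∀ x b, ∃ i, ∃ c ∈ β i, IsSegmentOf (F x b) c) →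
          (∀ x, ∀ b b', b ≠ b' → Disjoint (F x b) (F x b')) →
          ∃ (P : Fin n → Fin M) (g : Fin n → Fin n),
            Function.Injective P ∧
            ∀ j j' : Fin n, j ≠ j' → Disjoint (F (P j) (g j)) (F (P j') (g j')) := by
  set X : ℝ := (k : ℝ) ^ (((t : ℝ) * ((k : ℝ) - 1) ^ 3 / (2 * (k : ℝ) ^ 3)) * (n : ℝ) ^ 4) with hX
  have hk1 : (1 : ℝ) ≤ k := by exact_mod_cast hk
  have hX1 : 1 ≤ X := by
    apply Real.one_le_rpow hk1
    have : (0 : ℝ) ≤ (k : ℝ) - 1 := by linarith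
    positivity
  have hchoose : 0 < (n + k - 1).choose (k - 1) := Nat.choose_pos (by omega)
  have hchooseR : (0 : ℝ) < ((n + k - 1).choose (k - 1) : ℝ) := by exact_mod_cast hchoose
  have hnR : (0 : ℝ) < n := by exact_mod_cast hn
  refine ⟨_, ?_, le_rfl, ?_⟩
  · rw [Nat.ceil_pos]
    positivity
  intro β hβ hβt F hF hfam
  classical
  choose cl cv hcv hseg using hF
  generalize hM : ⌈((n + k - 1).choose (k - 1) : ℝ) * n * X⌉₊ = M at *
  have hMle : ((n + k - 1).choose (k - 1) : ℝ) * n * X ≤ M := hM ▸ Nat.le_ceil _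
  let ty : Fin M → Sym (Fin k) n := fun x => ⟨Finset.univ.val.map (cl x), by simp⟩
  have hcard : Fintype.card (Sym (Fin k) n) = (n + k - 1).choose (k - 1) := by
    rw [Sym.card_sym_eq_choose, Fintype.card_fin, add_comm k n, ← Nat.choose_symm (by omega)]
    congr 1
    omega
  obtain ⟨σ, hσ⟩ : ∃ σ : Sym (Fin k) n,
      (n : ℝ) * X ≤ ((Finset.univ.filter (fun x => ty x = σ)).card : ℝ) := by
    by_contra hcon
    push Not at hcon
    have hsum : (M : ℝ) = ∑ σ : Sym (Fin k) n,
        ((Finset.univ.filter (fun x => ty x = σ)).card : ℝ) := by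
      have := Finset.card_eq_sum_card_fiberwise (f := ty) (s := Finset.univ) (t := Finset.univ)
        (by intro x _; simp)
      rw [Finset.card_univ, Fintype.card_fin] at this
      exact_mod_cast this
    have hne : (Finset.univ : Finset (Sym (Fin k) n)).Nonempty := by
      rw [← Finset.card_pos, Finset.card_univ, hcard]
      exact hchoose
    have hlt := Finset.sum_lt_sum_of_nonempty hne (fun σ _ => hcon σ)
    rw [← hsum, Finset.sum_const, Finset.card_univ, hcard, nsmul_eq_mul, ← mul_assoc] at hlt
    linarith
  set Q := Finset.univ.filter (fun x => ty x = σ) with hQdef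
  let τ : Fin k → ℕ := fun i => Multiset.count i (σ : Multiset (Fin k))
  have hτ : ∀ x ∈ Q, ∀ i, (Finset.univ.filter (fun b => cl x b = i)).card = τ i := by
    intro x hx i
    have h := (Finset.mem_filter.mp hx).2
    simp only [τ, ← h, ty]
    change _ = Multiset.count i (Finset.univ.val.map (cl x))
    rw [Multiset.count_map, Finset.card_def, Finset.filter_val]
    simp only [eq_comm]
  have hτn : ∑ i, τ i = n := by
    have := Multiset.sum_count_eq_card (s := Finset.univ) (m := (σ : Multiset (Fin k)))
      (by simp)
    rw [Sym.card_coe] at this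
    exact this
  have hsimp : ∀ i, ∀ U : Finset (Fin M × Fin n), (∀ e ∈ U, cl e.1 e.2 = i) → U.Nonempty →
      ∃ e ∈ U, ∃ p ∈ F e.1 e.2, ∀ e' ∈ U, ¬ Disjoint (F e.1 e.2) (F e'.1 e'.2) →
        p ∈ F e'.1 e'.2 := by
    intro i U hU hne
    exact sdr_simplicial (β i) (hβ i) (fun e : Fin M × Fin n => F e.1 e.2)
      (fun e => cv e.1 e.2) (fun e => hseg e.1 e.2) U
      (fun e he => hU e he ▸ hcv e.1 e.2) hne
  obtain ⟨S, hS⟩ : ∃ S, S = Finset.univ.filter (fun i => τ i ≠ 0) := ⟨_, rfl⟩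
  by_cases hS2 : 2 ≤ S.card
  · refine sdr_mixed hn ht β hβ hβt F hfam cl cv hcv hseg τ Q hτ hτn S hS hS2 ?_
    have hSk : S.card ≤ k := by simpa using Finset.card_le_univ S
    have hSn : S.card ≤ n := by
      calc S.card = ∑ i ∈ S, 1 := Finset.card_eq_sum_ones S
        _ ≤ ∑ i ∈ S, τ i := Finset.sum_le_sum (fun i hi => by
            rw [hS, Finset.mem_filter] at hi
            have := hi.2
            omega)
        _ ≤ ∑ i, τ i := Finset.sum_le_sum_of_subset (Finset.subset_univ _)
        _ = n := hτn
    have hexp := sdr_exponent n k t S.card _ hS2 hSn hSk (sdr_pairs S)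
    set E := (S.offDiag.filter (fun q => q.1 < q.2)).card * ((n - 1) * (n - 1)) * t
    have hk2 : (2 : ℝ) ≤ k := by exact_mod_cast hS2.trans hSk
    have h2 : (2 : ℝ) ^ E ≤ X := by
      calc (2 : ℝ) ^ E ≤ (k : ℝ) ^ E := by gcongr
        _ = (k : ℝ) ^ (E : ℝ) := (Real.rpow_natCast _ _).symm
        _ ≤ X := Real.rpow_le_rpow_of_exponent_le hk1 hexp
    have h3 : (n : ℝ) * 2 ^ E ≤ Q.card := (mul_le_mul_of_nonneg_left h2 hnR.le).trans hσ
    exact_mod_cast h3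
  · have hQn : n ≤ Q.card := by
      have : (n : ℝ) ≤ Q.card := by nlinarith
      exact_mod_cast this
    refine sdr_finish hn F hfam cl hsimp τ Q hQn hτ ?_
    intro x hx y hy b b' hne
    exfalso
    have hmem : ∀ x ∈ Q, ∀ b, cl x b ∈ S := by
      intro x hx b
      rw [hS]
      simp only [Finset.mem_filter, Finset.mem_univ, true_and]
      rw [← hτ x hx]
      exact (Finset.card_pos.mpr ⟨b, by simp⟩).ne'
    exact hne (Finset.card_le_one.mp (by omega) _ (hmem x hx b) _ (hmem y hy b'))
end

section
/- Let A_1,...,A_{2n-1} be sets, each consisting of n-1 pairwise disjoint horizontal closed line segments and one vertical closed line segment in the plane (the n segments in each A_i are pairwise disjoint). Then there exists a system of disjoint representatives of size n. -/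
/-- Greedy choice from the right: pick representatives with largest left end. -/
lemma greedy_right {L ι : Type*} [LinearOrder L] [DecidableEq ι] (i0 : ι) (f : ι → ℕ → L) (m : ℕ) :
    ∀ S : Finset ι, m ≤ S.card →
    ∃ τ : ℕ → ι, (∀ k < m, τ k ∈ S) ∧ (∀ k < m, ∀ k' < m, τ k = τ k' → k = k') ∧
      ∀ k < m, ∀ i ∈ S, (∀ k', k ≤ k' → k' < m → τ k' ≠ i) → f i k ≤ f (τ k) k := by
  induction m with
  | zero => intro S _; exact ⟨fun _ => i0, by simp, by simp, by simp⟩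
  | succ m ih =>
    intro S hS
    have hne : S.Nonempty := by
      rw [← Finset.card_pos]; omega
    obtain ⟨t, htS, ht⟩ := Finset.exists_max_image S (fun i => f i m) hne
    obtain ⟨τ, h1, h2, h3⟩ := ih (S.erase t) (by rw [Finset.card_erase_of_mem htS]; omega)
    refine ⟨fun k => if k < m then τ k else t, ?_, ?_, ?_⟩
    · intro k hk
      by_cases h : k < m
      · simp only [h, if_true]; exact Finset.mem_of_mem_erase (h1 k h)
      · simpa only [h, if_false] using htS
    · intro k hk k' hk' h
      have e1 := fun k hk => Finset.ne_of_mem_erase (h1 k hk)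
      by_cases a : k < m <;> by_cases b : k' < m <;> simp only [a, b, if_true, if_false] at h
      · exact h2 k a k' b h
      · exact absurd h (e1 k a)
      · exact absurd h.symm (e1 k' b)
      · omega
    · intro k hk i hi hn
      by_cases a : k < m
      · simp only [a, if_true]
        refine h3 k a i (Finset.mem_erase.2 ⟨?_, hi⟩) ?_
        · have := hn m (by omega) (by omega)
          simp at this
          exact fun h => this h.symm
        · intro k' h1 h2
          have := hn k' h1 (by omega)
          simpa [h2] using this
      · simp only [a, if_false]
        have : k = m := by omega
        subst this
        exact ht i hi

/-- Greedy choice from the left: pick representatives with smallest right end. -/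
lemma greedy_left {L ι : Type*} [LinearOrder L] [Fintype ι] [DecidableEq ι] (i0 : ι)
    (m : ℕ) (lo hi : ι → ℕ → L) (hlt : ∀ i, ∀ j j', j < j' → j' < m → hi i j < lo i j')
    (hm : m ≤ Fintype.card ι) :
    ∀ K ≤ m, ∃ (σ : ℕ → ι) (q : ℕ → ℕ), (∀ k < K, q k < m) ∧
      (∀ k < K, ∀ k' < K, σ k = σ k' → k = k') ∧
      (∀ k k', k < k' → k' < K → hi (σ k) (q k) < lo (σ k') (q k')) ∧
      ∀ i, (∀ k < K, σ k ≠ i) →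
        (∀ k < K, lo i k ≤ hi (σ k) (q k) ∧ hi (σ k) (q k) ≤ hi i k) ∨
        (∃ t < K, ∀ k < K, hi (σ k) (q k) < lo i t) := by
  intro K
  induction K with
  | zero => intro _; exact ⟨fun _ => i0, fun _ => 0, by simp, by simp, by simp, by simp⟩
  | succ K ih =>
    intro hK
    obtain ⟨σ, q, h1, h2, h3, h4⟩ := ih (by omega)
    have hmono : ∀ k < K, ∀ k' < K, k ≤ k' → lo (σ k') (q k') ≤ hi (σ k') (q k') →
        hi (σ k) (q k) ≤ hi (σ k') (q k') := by
      intro k hk k' hk' hkk hle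
      rcases hkk.eq_or_lt with h | h
      · rw [h]
      · exact (h3 k k' h hk').le.trans hle
    have hcand : ∀ i, (∀ k < K, σ k ≠ i) → ∃ j ≤ K, ∀ k < K, hi (σ k) (q k) < lo i j := by
      intro i hi'
      rcases h4 i hi' with h | ⟨t, ht, h⟩
      · exact ⟨K, le_rfl, fun k hk => (h k hk).2.trans_lt (hlt i k K hk (by omega))⟩
      · exact ⟨t, ht.le, h⟩
    classical
    let C : Finset (ι × ℕ) := (Finset.univ ×ˢ Finset.range m).filter
      (fun c => (∀ k < K, σ k ≠ c.1) ∧ ∀ k < K, hi (σ k) (q k) < lo c.1 c.2)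
    have memC : ∀ i j, (i, j) ∈ C ↔ j < m ∧ (∀ k < K, σ k ≠ i) ∧
        ∀ k < K, hi (σ k) (q k) < lo i j := by
      intro i j; simp [C]
    have hex : ∃ i, ∀ k < K, σ k ≠ i := by
      by_contra hcon
      push Not at hcon
      have : (Finset.univ : Finset ι) ⊆ (Finset.range K).image σ := by
        intro i _
        obtain ⟨k, hk, h⟩ := hcon i
        exact Finset.mem_image.2 ⟨k, Finset.mem_range.2 hk, h⟩
      have h5 := Finset.card_le_card this
      have h6 := Finset.card_image_le (s := Finset.range K) (f := σ)
      rw [Finset.card_univ] at h5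
      rw [Finset.card_range] at h6
      omega
    have hCne : C.Nonempty := by
      obtain ⟨i, hi'⟩ := hex
      obtain ⟨j, hj, h⟩ := hcand i hi'
      exact ⟨(i, j), (memC i j).2 ⟨by omega, hi', h⟩⟩
    obtain ⟨⟨s, r⟩, hsr, hmin⟩ := Finset.exists_min_image C (fun c => hi c.1 c.2) hCne
    obtain ⟨hr, hs, hlo⟩ := (memC s r).1 hsr
    have hmin' : ∀ i j, j < m → (∀ k < K, σ k ≠ i) → (∀ k < K, hi (σ k) (q k) < lo i j) →
        hi s r ≤ hi i j := fun i j a b c => hmin (i, j) ((memC i j).2 ⟨a, b, c⟩)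
    refine ⟨fun k => if k < K then σ k else s, fun k => if k < K then q k else r, ?_, ?_, ?_, ?_⟩
    · intro k hk
      by_cases a : k < K
      · simpa [a] using h1 k a
      · simpa [a] using hr
    · intro k hk k' hk' h
      by_cases a : k < K <;> by_cases b : k' < K <;> simp only [a, b, if_true, if_false] at h
      · exact h2 k a k' b h
      · exact absurd h (hs k a)
      · exact absurd h.symm (hs k' b)
      · omega
    · intro k k' hkk hk'
      have a : k < K := by omega
      by_cases b : k' < K
      · simpa [a, b] using h3 k k' hkk b
      · simpa [a, b] using hlo k a
    · intro i hi'
      have hu : ∀ k < K, σ k ≠ i := by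
        intro k hk
        simpa [hk] using hi' k (by omega)
      have key : ∀ t < m, hi s r < lo i t → (∀ k < K, hi (σ k) (q k) < lo i t) →
          ∀ k < K + 1, hi (if k < K then σ k else s) (if k < K then q k else r) < lo i t := by
        intro t _ h5 h6 k hk
        by_cases a : k < K
        · simpa [a] using h6 k a
        · simpa [a] using h5
      rcases h4 i hu with h | ⟨t, ht, h⟩
      · have hc : ∀ k < K, hi (σ k) (q k) < lo i K :=
          fun k hk => (h k hk).2.trans_lt (hlt i k K hk (by omega))
        have h7 := hmin' i K (by omega) hu hc
        by_cases h8 : lo i K ≤ hi s r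
        · left
          intro k hk
          by_cases a : k < K
          · simpa [a] using h k a
          · have : k = K := by omega
            subst this
            simpa using ⟨h8, h7⟩
        · right
          exact ⟨K, by omega, key K (by omega) (not_le.1 h8) hc⟩
      · right
        have h7 := hmin' i t (by omega) hu h
        have h9 := hlt i t (t + 1) (by omega) (by omega)
        by_cases hle : lo i t ≤ hi i t
        · exact ⟨t + 1, by omega, key (t + 1) (by omega) (h7.trans_lt h9)
            fun k hk => (h k hk).trans (hle.trans_lt h9)⟩
        · exact ⟨t, by omega, key t (by omega) (h7.trans_lt (not_le.1 hle)) h⟩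

/-- Appending one more representative. -/
lemma append_rep {L ι : Type*} (m : ℕ) (σ : ℕ → ι) (s : ℕ → Set L) (i : ι) (W : Set L)
    (G : ι → Set L → Prop)
    (h1 : ∀ k < m, ∀ k' < m, σ k = σ k' → k = k') (h2 : ∀ k < m, σ k ≠ i)
    (h3 : ∀ k k', k < k' → k' < m → Disjoint (s k) (s k')) (h4 : ∀ k < m, Disjoint (s k) W)
    (h5 : ∀ k < m, G (σ k) (s k)) (h6 : G i W) :
    ∃ (p : Fin (m + 1) → ι) (t : Fin (m + 1) → Set L), Function.Injective p ∧
      (∀ j, G (p j) (t j)) ∧ ∀ j j', j ≠ j' → Disjoint (t j) (t j') := by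
  refine ⟨fun k => if k.1 < m then σ k else i, fun k => if k.1 < m then s k else W, ?_, ?_, ?_⟩
  · intro k k' h
    apply Fin.ext
    have := k.2
    have := k'.2
    by_cases a : k.1 < m <;> by_cases b : k'.1 < m <;> simp only [a, b, if_true, if_false] at h
    · exact h1 k a k' b h
    · exact absurd h (h2 k a)
    · exact absurd h.symm (h2 k' b)
    · omega
  · intro k
    by_cases a : k.1 < m
    · simpa [a] using h5 k a
    · simpa [a] using h6
  · have main : ∀ k k' : Fin (m + 1), k.1 < k'.1 →
        Disjoint (if k.1 < m then s k else W) (if k'.1 < m then s k' else W) := by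
      intro k k' h
      have := k'.2
      have a : k.1 < m := by omega
      by_cases b : k'.1 < m
      · simpa [a, b] using h3 k k' h b
      · simpa [a, b] using h4 k a
    intro k k' h
    rcases lt_or_gt_of_ne (fun e => h (Fin.ext e)) with h | h
    · exact main k k' h
    · exact (main k' k h).symm

lemma disj_Icc {L : Type*} [LinearOrder L] {a b c d : L} (h : b < c) :
    Disjoint (Set.Icc a b) (Set.Icc c d) :=
  Set.disjoint_left.2 fun _ hx hy => absurd (hx.2.trans_lt h) (not_lt.2 hy.1)

/-- The combinatorial core, in a linear order `L` (the plane read line by line). -/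
lemma core {L ι : Type*} [LinearOrder L] [Fintype ι] (ℓ : L → ℝ) (m : ℕ)
    (hcard : Fintype.card ι = 2 * m + 1) (lo hi : ι → ℕ → L)
    (hle : ∀ i, ∀ j < m, lo i j ≤ hi i j)
    (hlt : ∀ i, ∀ j j', j < j' → j' < m → hi i j < lo i j')
    (hline : ∀ i, ∀ j < m, ∀ x ∈ Set.Icc (lo i j) (hi i j), ∀ y ∈ Set.Icc (lo i j) (hi i j),
      ℓ x = ℓ y)
    (W : ι → Set L) (hW : ∀ i, ∀ x ∈ W i, ∀ y ∈ W i, ℓ x = ℓ y → x = y)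
    (hHW : ∀ i, ∀ j < m, Disjoint (Set.Icc (lo i j) (hi i j)) (W i)) :
    ∃ (p : Fin (m + 1) → ι) (s : Fin (m + 1) → Set L), Function.Injective p ∧
      (∀ j, (∃ k < m, s j = Set.Icc (lo (p j) k) (hi (p j) k)) ∨ s j = W (p j)) ∧
      ∀ j j', j ≠ j' → Disjoint (s j) (s j') := by
  classical
  have hne : Nonempty ι := Fintype.card_pos_iff.1 (by omega)
  obtain ⟨i0⟩ := hne
  obtain ⟨σ, q, s1, s2, s3, s4⟩ := greedy_left i0 m lo hi hlt (by omega) m le_rfl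
  let G : ι → Set L → Prop := fun i t => (∃ k < m, t = Set.Icc (lo i k) (hi i k)) ∨ t = W i
  by_cases hA : ∃ i, (∀ k < m, σ k ≠ i) ∧ ∃ t < m, ∀ k < m, hi (σ k) (q k) < lo i t
  · obtain ⟨i, hi1, t, ht, h⟩ := hA
    exact append_rep m σ (fun k => Set.Icc (lo (σ k) (q k)) (hi (σ k) (q k))) i
      (Set.Icc (lo i t) (hi i t)) G s2 hi1 (fun k k' a b => disj_Icc (s3 k k' a b))
      (fun k hk => disj_Icc (h k hk)) (fun k hk => Or.inl ⟨q k, s1 k hk, rfl⟩)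
      (Or.inl ⟨t, ht, rfl⟩)
  have s5 : ∀ i, (∀ k < m, σ k ≠ i) →
      ∀ k < m, lo i k ≤ hi (σ k) (q k) ∧ hi (σ k) (q k) ≤ hi i k := by
    intro i hi1
    rcases s4 i hi1 with h | h
    · exact h
    · exact absurd ⟨i, hi1, h⟩ hA
  let T : Finset ι := Finset.univ \ (Finset.range m).image σ
  have hT : ∀ i ∈ T, ∀ k < m, σ k ≠ i := by
    intro i hi1 k hk h
    simp only [T, Finset.mem_sdiff] at hi1
    exact hi1.2 (Finset.mem_image.2 ⟨k, Finset.mem_range.2 hk, h⟩)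
  have hTc : m + 1 ≤ T.card := by
    have h1 := Finset.card_image_le (s := Finset.range m) (f := σ)
    have h2 := Finset.le_card_sdiff ((Finset.range m).image σ) (Finset.univ : Finset ι)
    rw [Finset.card_univ] at h2
    rw [Finset.card_range] at h1
    change _ ≤ T.card at h2
    omega
  obtain ⟨τ, t1, t2, t3⟩ := greedy_right i0 lo m T (by omega)
  have hj : ∃ j ∈ T, j ∉ (Finset.range m).image τ := by
    apply Finset.exists_mem_notMem_of_card_lt_card
    have h1 := Finset.card_image_le (s := Finset.range m) (f := τ)
    rw [Finset.card_range] at h1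
    omega
  obtain ⟨j, hjT, hj⟩ := hj
  have hjτ : ∀ k < m, τ k ≠ j := fun k hk h =>
    hj (Finset.mem_image.2 ⟨k, Finset.mem_range.2 hk, h⟩)
  have hjσ := hT j hjT
  have hτσ : ∀ k < m, ∀ k' < m, σ k ≠ τ k' := fun k hk k' hk' => hT _ (t1 k' hk') k hk
  set r : ℕ → L := fun k => hi (σ k) (q k) with hr
  have rj : ∀ k < m, r k ∈ Set.Icc (lo j k) (hi j k) := fun k hk => s5 j hjσ k hk
  have rτ : ∀ k < m, ∀ k' < m, r k ∈ Set.Icc (lo (τ k') k) (hi (τ k') k) :=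
    fun k hk k' hk' => s5 (τ k') (hT _ (t1 k' hk')) k hk
  have loj : ∀ k < m, lo j k ≤ lo (τ k) k :=
    fun k hk => t3 k hk j hjT fun k' _ h => hjτ k' h
  have rmono : ∀ k k', k < k' → k' < m → r k < r k' := fun k k' h h' =>
    (s3 k k' h h').trans_le (hle _ _ (s1 k' h'))
  let P : ℕ → Prop := fun k => ∃ w ∈ W j, ℓ w = ℓ (r k) ∧ w ≤ r k
  have hσr : ∀ k < m, r k ∈ Set.Icc (lo (σ k) (q k)) (hi (σ k) (q k)) :=
    fun k hk => ⟨hle _ _ (s1 k hk), le_rfl⟩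
  refine append_rep m (fun k => if P k then τ k else σ k)
    (fun k => if P k then Set.Icc (lo (τ k) k) (hi (τ k) k)
      else Set.Icc (lo (σ k) (q k)) (hi (σ k) (q k))) j (W j) G ?_ ?_ ?_ ?_ ?_ (Or.inr rfl)
  · intro k hk k' hk' h
    by_cases a : P k <;> by_cases b : P k' <;> simp only [a, b, if_true, if_false] at h
    · exact t2 k hk k' hk' h
    · exact absurd h.symm (hτσ k' hk' k hk)
    · exact absurd h (hτσ k hk k' hk')
    · exact s2 k hk k' hk' h
  · intro k hk
    by_cases a : P k <;> simp only [a, if_true, if_false]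
    · exact hjτ k hk
    · exact hjσ k hk
  · intro k k' hkk hk'
    have hk : k < m := hkk.trans hk'
    by_cases a : P k <;> by_cases b : P k' <;> simp only [a, b, if_true, if_false]
    · apply disj_Icc
      refine (hlt (τ k) k k' hkk hk').trans_le (t3 k' hk' _ (t1 k hk) ?_)
      intro k'' h1 h2 h3
      have := t2 k'' h2 k hk h3
      omega
    · refine Set.disjoint_left.2 fun x hx hy => b ?_
      obtain ⟨w, hw, hwl, hwr⟩ := a
      refine ⟨w, hw, ?_, hwr.trans (rmono k k' hkk hk').le⟩
      rw [hwl, hline _ k hk _ (rτ k hk k hk) x hx]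
      exact hline _ _ (s1 k' hk') x hy _ (hσr k' hk')
    · apply disj_Icc
      exact (rj k hk).2.trans_lt ((hlt j k k' hkk hk').trans_le (loj k' hk'))
    · exact disj_Icc (s3 k k' hkk hk')
  · intro k hk
    by_cases a : P k <;> simp only [a, if_true, if_false]
    · obtain ⟨w, hw, hwl, hwr⟩ := a
      have hwlo : w < lo j k := by
        by_contra hcon
        exact Set.disjoint_left.1 (hHW j k hk) ⟨not_lt.1 hcon, hwr.trans (rj k hk).2⟩ hw
      refine Set.disjoint_left.2 fun x hx hxW => ?_
      have : x = w := hW j x hxW w hw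
        ((hline _ k hk x hx _ (rτ k hk k hk)).trans hwl.symm)
      subst this
      exact absurd (hwlo.trans_le (loj k hk)) (not_lt.2 hx.1)
    · refine Set.disjoint_left.2 fun x hx hxW => a ?_
      exact ⟨x, hxW, hline _ _ (s1 k hk) x hx _ (hσr k hk), hx.2⟩
  · intro k hk
    by_cases a : P k <;> simp only [a, if_true, if_false]
    · exact Or.inl ⟨k, hk, rfl⟩
    · exact Or.inl ⟨q k, s1 k hk, rfl⟩

/-- The plane read line by line. -/
def lexPt (p : ℝ × ℝ) : ℝ ×ₗ ℝ := toLex (p.2, p.1)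

lemma seg_eq (a b y : ℝ) :
    Set.Icc a b ×ˢ ({y} : Set ℝ) = lexPt ⁻¹' Set.Icc (lexPt (a, y)) (lexPt (b, y)) := by
  ext ⟨u, v⟩
  simp only [Set.mem_prod, Set.mem_Icc, Set.mem_singleton_iff, Set.mem_preimage, lexPt,
    Prod.Lex.toLex_le_toLex]
  constructor
  · rintro ⟨⟨h1, h2⟩, rfl⟩
    exact ⟨Or.inr ⟨rfl, h1⟩, Or.inr ⟨rfl, h2⟩⟩
  · rintro ⟨h1 | ⟨h1, h2⟩, h3 | ⟨h3, h4⟩⟩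
    · exact absurd h1 (not_lt.2 h3.le)
    · exact absurd h1 (by rw [h3]; exact lt_irrefl _)
    · exact absurd h3 (by rw [h1]; exact lt_irrefl _)
    · exact ⟨⟨h2, h4⟩, h3⟩

lemma lexPt_surj (z : ℝ ×ₗ ℝ) : ∃ p, lexPt p = z := ⟨((ofLex z).2, (ofLex z).1), rfl⟩

/-- Theorem 4.1: `2n-1` families, each of `n-1` horizontal segments and one vertical
segment (all `n` pairwise disjoint), have an SDR of size `n`. -/
theorem stmt_7 (n : ℕ) (hn : 0 < n)
    (H : Fin (2 * n - 1) → Fin (n - 1) → Set (ℝ × ℝ))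
    (V : Fin (2 * n - 1) → Set (ℝ × ℝ))
    (hH : ∀ i j, ∃ a b y : ℝ, a ≤ b ∧ H i j = Set.Icc a b ×ˢ {y})
    (hV : ∀ i, ∃ x c d : ℝ, c ≤ d ∧ V i = {x} ×ˢ Set.Icc c d)
    (hHH : ∀ i, ∀ j j', j ≠ j' → Disjoint (H i j) (H i j'))
    (hHV : ∀ i j, Disjoint (H i j) (V i)) :
    ∃ (p : Fin n → Fin (2 * n - 1)) (sel : Fin n → Set (ℝ × ℝ)),
      Function.Injective p ∧
      (∀ j, (∃ h, sel j = H (p j) h) ∨ sel j = V (p j)) ∧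
      ∀ j j', j ≠ j' → Disjoint (sel j) (sel j') := by
  obtain ⟨m, rfl⟩ : ∃ m, n = m + 1 := ⟨n - 1, by omega⟩
  have hmm : m + 1 - 1 = m := rfl
  choose a b y hab hHe using hH
  let lo0 : Fin (2 * (m + 1) - 1) → Fin (m + 1 - 1) → ℝ ×ₗ ℝ := fun i j => lexPt (a i j, y i j)
  let hi0 : Fin (2 * (m + 1) - 1) → Fin (m + 1 - 1) → ℝ ×ₗ ℝ := fun i j => lexPt (b i j, y i j)
  have hH0 : ∀ i j, H i j = lexPt ⁻¹' Set.Icc (lo0 i j) (hi0 i j) := by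
    intro i j; rw [hHe, seg_eq]
  have hle0 : ∀ i j, lo0 i j ≤ hi0 i j := by
    intro i j
    simp only [lo0, hi0, lexPt, Prod.Lex.toLex_le_toLex]
    exact Or.inr ⟨trivial, hab i j⟩
  let e := fun i => Tuple.sort (lo0 i)
  have he : ∀ i, Monotone (lo0 i ∘ e i) := fun i => Tuple.monotone_sort (lo0 i)
  let z : ℝ ×ₗ ℝ := lexPt (0, 0)
  let lo : Fin (2 * (m + 1) - 1) → ℕ → ℝ ×ₗ ℝ :=
    fun i k => if h : k < m then lo0 i (e i ⟨k, h⟩) else z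
  let hi : Fin (2 * (m + 1) - 1) → ℕ → ℝ ×ₗ ℝ :=
    fun i k => if h : k < m then hi0 i (e i ⟨k, h⟩) else z
  have lo_eq : ∀ i k (h : k < m), lo i k = lo0 i (e i ⟨k, h⟩) := fun i k h => dif_pos h
  have hi_eq : ∀ i k (h : k < m), hi i k = hi0 i (e i ⟨k, h⟩) := fun i k h => dif_pos h
  have hH1 : ∀ i k (h : k < m), H i (e i ⟨k, h⟩) = lexPt ⁻¹' Set.Icc (lo i k) (hi i k) := by
    intro i k h; rw [lo_eq i k h, hi_eq i k h, hH0]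
  let W : Fin (2 * (m + 1) - 1) → Set (ℝ ×ₗ ℝ) := fun i => {z | ∃ p ∈ V i, lexPt p = z}
  have hinj : ∀ p p', lexPt p = lexPt p' → p = p' := by
    rintro ⟨u, v⟩ ⟨u', v'⟩ h
    have h1 : v = v' := congrArg (fun w => (ofLex w).1) h
    have h2 : u = u' := congrArg (fun w => (ofLex w).2) h
    rw [h1, h2]
  have hVW : ∀ i, V i = lexPt ⁻¹' W i := by
    intro i
    ext p
    constructor
    · intro h; exact ⟨p, h, rfl⟩
    · rintro ⟨p', h, h'⟩
      rw [← hinj _ _ h']; exact h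
  obtain ⟨p, s, h1, h2, h3⟩ := core (fun w : ℝ ×ₗ ℝ => (ofLex w).1) m
    (ι := Fin (2 * (m + 1) - 1)) (by rw [Fintype.card_fin]; omega) lo hi
    (by intro i j hj; rw [lo_eq i j hj, hi_eq i j hj]; exact hle0 _ _)
    (by
      intro i j j' hjj hj'
      have hj : j < m := hjj.trans hj'
      by_contra hcon
      have hmon : lo i j ≤ lo i j' := by
        rw [lo_eq i j hj, lo_eq i j' hj']
        exact he i (show (⟨j, hj⟩ : Fin (m + 1 - 1)) ≤ ⟨j', hj'⟩ from hjj.le)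
      have hd := hHH i (e i ⟨j, hj⟩) (e i ⟨j', hj'⟩) (by
        intro h
        have := congrArg Fin.val ((e i).injective h)
        simp at this
        omega)
      rw [hH1 i j hj, hH1 i j' hj'] at hd
      obtain ⟨x, hx⟩ := lexPt_surj (lo i j')
      have hle' : lo i j' ≤ hi i j' := by
        rw [lo_eq i j' hj', hi_eq i j' hj']; exact hle0 _ _
      have hd2 : x ∈ lexPt ⁻¹' Set.Icc (lo i j) (hi i j) →
          x ∉ lexPt ⁻¹' Set.Icc (lo i j') (hi i j') := fun h => Set.disjoint_left.1 hd h
      refine hd2 ?_ ?_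
      · rw [Set.mem_preimage, hx]; exact ⟨hmon, not_lt.1 hcon⟩
      · rw [Set.mem_preimage, hx]; exact ⟨le_rfl, hle'⟩)
    (by
      have aux : ∀ i, ∀ j (hj : j < m), ∀ x ∈ Set.Icc (lo i j) (hi i j),
          (ofLex x).1 = y i (e i ⟨j, hj⟩) := by
        intro i j hj x hx
        obtain ⟨x, rfl⟩ := lexPt_surj x
        have : x ∈ H i (e i ⟨j, hj⟩) := by rw [hH1]; exact hx
        rw [hHe] at this
        exact this.2
      intro i j hj x hx x' hx'
      exact (aux i j hj x hx).trans (aux i j hj x' hx').symm)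
    W
    (by
      rintro i x ⟨⟨u, v⟩, hp, rfl⟩ x' ⟨⟨u', v'⟩, hp', rfl⟩ h
      obtain ⟨x0, c, d, _, hVi⟩ := hV i
      rw [hVi] at hp hp'
      have e1 : u = x0 := hp.1
      have e2 : u' = x0 := hp'.1
      have e3 : v = v' := h
      rw [e1, e2, e3])
    (by
      intro i j hj
      have hd := hHV i (e i ⟨j, hj⟩)
      rw [hH1 i j hj] at hd
      refine Set.disjoint_left.2 ?_
      rintro x hx ⟨p, hp, rfl⟩
      exact Set.disjoint_left.1 hd hx hp)
  refine ⟨p, fun j => lexPt ⁻¹' s j, h1, ?_, fun j j' h => (h3 j j' h).preimage _⟩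
  intro j
  rcases h2 j with ⟨k, hk, h⟩ | h
  · left
    exact ⟨e (p j) ⟨k, hk⟩, by rw [hH1, ← h]⟩
  · right
    rw [hVW, ← h]
end
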